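/- There exist ω₀ > 0, M₀ > 0, complex numbers C₋₁ʲ and C_kʲ (j = 1, …, s; k = 0, 1, 2, …), vectors x_k ∈ ℂⁿ, and continuous 2π-periodic vector functions y_k : ℝ → ℂⁿ with zero mean ⟨y_k⟩ = 0, such that for every ω > ω₀ the unique (2π/ω)-periodic solution x of system (1) is represented by the series x(t) = ω Σ_{j=1}^s C₋₁ʲ a_j + Σ_{k=0}^∞ ω^{−k}(x_k + y_k(ωt) + Σ_{j=1}^s C_kʲ a_j), which converges absolutely and uniformly on ℝ, and for every integer r ≥ 0 and all t ∈ ℝ one has |x(t) − ω Σ_{j=1}^s C₋₁ʲ a_j − Σ_{k=0}^r ω^{−k}(x_k + y_k(ωt) + Σ_{j=1}^s C_kʲ a_j)| ≤ M₀^{r+1}/ω^{r+1}. -/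

import Mathlib

open Matrix Finset

/-- The Euclidean norm on `ℂⁿ`. -/
noncomputable def euclNorm {n : ℕ} (v : Fin n → ℂ) : ℝ :=
  Real.sqrt (∑ i, ‖v i‖ ^ 2)

open BoundedContinuousFunction

/-! ### Abstract power series lemma -/

noncomputable def useq {U : Type*} [NormedAddCommGroup U] [NormedSpace ℂ U]
    (T₁ T₂ : U →L[ℂ] U) (b₀ b₁ : U) : ℕ → U
  | 0 => b₀
  | 1 => b₁ + T₁ b₀
  | (k + 2) => T₁ (useq T₁ T₂ b₀ b₁ (k + 1)) + T₂ (useq T₁ T₂ b₀ b₁ k)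

theorem useq_bound {U : Type*} [NormedAddCommGroup U] [NormedSpace ℂ U]
    (T₁ T₂ : U →L[ℂ] U) (b₀ b₁ : U) (k : ℕ) :
    ‖useq T₁ T₂ b₀ b₁ k‖ ≤ (1 + ‖b₀‖ + ‖b₁ + T₁ b₀‖) * (1 + ‖T₁‖ + ‖T₂‖) ^ k := by
  set K := (1 + ‖b₀‖ + ‖b₁ + T₁ b₀‖) with hK
  set ρ := (1 + ‖T₁‖ + ‖T₂‖) with hρ
  have h1 := norm_nonneg b₀
  have h2 := norm_nonneg (b₁ + T₁ b₀)
  have h3 := norm_nonneg T₁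
  have h4 := norm_nonneg T₂
  have hK1 : 0 ≤ K := by linarith
  have hρ1 : 1 ≤ ρ := by linarith
  induction k using Nat.twoStepInduction with
  | zero => simp only [useq, pow_zero]; linarith
  | one => simp only [useq, pow_one]; nlinarith
  | more k ih1 ih2 =>
    simp only [useq]
    have e1 := (T₁.le_opNorm_of_le ih2)
    have e2 := (T₂.le_opNorm_of_le ih1)
    have e3 : K * ρ ^ k ≤ K * ρ ^ (k + 1) := by
      exact mul_le_mul_of_nonneg_left (pow_le_pow_right₀ hρ1 (Nat.le_succ k)) hK1
    have e4 : 0 ≤ K * ρ ^ (k+1) := by positivity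
    calc _ ≤ _ := norm_add_le _ _
      _ ≤ ‖T₁‖ * (K * ρ ^ (k + 1)) + ‖T₂‖ * (K * ρ ^ (k+1)) := by
        have := mul_le_mul_of_nonneg_left e3 h4
        linarith
      _ ≤ ρ * (K * ρ ^ (k + 1)) := by rw [hρ] at *; nlinarith
      _ = _ := by ring

theorem useq_mem {U : Type*} [NormedAddCommGroup U] [NormedSpace ℂ U]
    (T₁ T₂ : U →L[ℂ] U) (b₀ b₁ : U) (P : Submodule ℂ U) (h0 : b₀ ∈ P) (h1 : b₁ ∈ P)
    (hT₁ : ∀ u, T₁ u ∈ P) (hT₂ : ∀ u, T₂ u ∈ P) (k : ℕ) : useq T₁ T₂ b₀ b₁ k ∈ P := by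
  match k with
  | 0 => exact h0
  | 1 => exact P.add_mem h1 (hT₁ _)
  | (k + 2) => exact P.add_mem (hT₁ _) (hT₂ _)

theorem useq_tendsto {U : Type*} [NormedAddCommGroup U] [NormedSpace ℂ U]
    (T₁ T₂ : U →L[ℂ] U) (b₀ b₁ : U) (ε : ℂ) (hε : ‖ε‖ * (1 + ‖T₁‖ + ‖T₂‖) ≤ 1 / 2)
    (v : U) (hv : v = b₀ + ε • b₁ + ε • T₁ v + ε ^ 2 • T₂ v) :
    Filter.Tendsto (fun r => ∑ k ∈ Finset.range r, ε ^ k • useq T₁ T₂ b₀ b₁ k)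
      Filter.atTop (nhds v) := by
  set R : ℕ → U := fun r => v - ∑ k ∈ Finset.range r, ε ^ k • useq T₁ T₂ b₀ b₁ k with hR
  have hrec : ∀ r, R (r + 2) = ε • T₁ (R (r + 1)) + ε ^ 2 • T₂ (R r) := by
    intro r
    induction r with
    | zero =>
      simp only [hR, Finset.sum_range_succ, Finset.sum_range_zero, useq, map_sub,
        pow_zero, pow_one, one_smul, zero_add, sub_zero, smul_sub, smul_add]
      nth_rw 1 [hv]
      abel
    | succ r ih =>
      have e1 : R (r + 1 + 2) = R (r + 2) - ε ^ (r + 2) • useq T₁ T₂ b₀ b₁ (r + 2) := by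
        simp only [hR]; rw [Finset.sum_range_succ _ (r + 2)]; abel
      have e2 : R (r + 1 + 1) = R (r + 1) - ε ^ (r + 1) • useq T₁ T₂ b₀ b₁ (r + 1) := by
        simp only [hR]; rw [Finset.sum_range_succ _ (r + 1)]; abel
      have e3 : R (r + 1) = R r - ε ^ r • useq T₁ T₂ b₀ b₁ r := by
        simp only [hR]; rw [Finset.sum_range_succ _ r]; abel
      calc R (r + 1 + 2) = ε • T₁ (R (r + 1)) + ε ^ 2 • T₂ (R r)
            - ε ^ (r + 2) • useq T₁ T₂ b₀ b₁ (r + 2) := by rw [e1, ih]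
        _ = ε • T₁ (R (r + 1) - ε ^ (r + 1) • useq T₁ T₂ b₀ b₁ (r + 1)) +
            ε ^ 2 • T₂ (R r - ε ^ r • useq T₁ T₂ b₀ b₁ r) := by
          simp only [map_sub, map_smul, useq]
          module
        _ = _ := by rw [← e2, ← e3]
  have h3 := norm_nonneg T₁
  have h4 := norm_nonneg T₂
  have h5 := norm_nonneg ε
  have hε2 : ‖ε‖ ≤ 1 / 2 := by nlinarith
  set K := ‖R 0‖ + 2 * ‖R 1‖ with hK
  have hK0 : 0 ≤ K := by positivity
  have hb : ∀ r, ‖R r‖ ≤ K * (1 / 2) ^ r := by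
    intro r
    induction r using Nat.twoStepInduction with
    | zero => have := norm_nonneg (R 1); simp only [pow_zero]; linarith
    | one => have := norm_nonneg (R 0); simp only [pow_one]; linarith
    | more k ih1 ih2 =>
      rw [hrec]
      have e1 := (T₁.le_opNorm_of_le ih2)
      have e2 := (T₂.le_opNorm_of_le ih1)
      have e4 : 0 ≤ K * (1 / 2 : ℝ) ^ (k+1) := by positivity
      have e5 : K * (1 / 2 : ℝ) ^ k = 2 * (K * (1 / 2 : ℝ) ^ (k + 1)) := by ring
      have e6 : K * (1 / 2 : ℝ) ^ (k + 2) = (1 / 2) * (K * (1 / 2 : ℝ) ^ (k + 1)) := by ring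
      rw [e6]
      rw [e5] at e2
      set D := K * (1 / 2 : ℝ) ^ (k + 1)
      calc _ ≤ _ := norm_add_le _ _
        _ ≤ ‖ε‖ * (‖T₁‖ * D) + ‖ε‖ ^ 2 * (‖T₂‖ * (2 * D)) := by
          rw [norm_smul, norm_smul, norm_pow]
          gcongr
        _ ≤ ‖ε‖ * (‖T₁‖ * D) + (‖ε‖ * (1 / 2)) * (‖T₂‖ * (2 * D)) := by
          rw [pow_two]; gcongr
        _ = (‖ε‖ * (‖T₁‖ + ‖T₂‖)) * D := by ring
        _ ≤ _ := by gcongr; nlinarith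
  have hz : Filter.Tendsto R Filter.atTop (nhds 0) := by
    apply squeeze_zero_norm hb
    have := (tendsto_pow_atTop_nhds_zero_of_lt_one (r := (1 / 2 : ℝ)) (by norm_num)
      (by norm_num)).const_mul K
    simpa using this
  have := (tendsto_const_nhds (x := v)).sub hz
  simpa [hR] using this

/-! ### The space of continuous periodic functions -/

noncomputable def PerSub (n : ℕ) : Submodule ℂ (ℝ →ᵇ (Fin n → ℂ)) where
  carrier := {f | ∀ τ, f (τ + 2 * Real.pi) = f τ}
  add_mem' := by
    intro f g hf hg τ
    simp [hf τ, hg τ]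
  zero_mem' := by intro τ; simp
  smul_mem' := by
    intro c f hf τ
    simp [hf τ]

def PerE (n : ℕ) : Type := PerSub n

noncomputable instance (n : ℕ) : NormedAddCommGroup (PerE n) :=
  inferInstanceAs (NormedAddCommGroup (PerSub n))

noncomputable instance (n : ℕ) : NormedSpace ℂ (PerE n) :=
  inferInstanceAs (NormedSpace ℂ (PerSub n))

theorem per_bdd {n : ℕ} (g : ℝ → Fin n → ℂ) (hc : Continuous g)
    (hp : ∀ τ, g (τ + 2 * Real.pi) = g τ) : ∃ C, ∀ τ, ‖g τ‖ ≤ C := by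
  have hp' : Function.Periodic g (2 * Real.pi) := hp
  have := hp'.isBounded_of_continuous (by positivity) hc
  obtain ⟨C, hC⟩ := this.exists_norm_le
  exact ⟨C, fun τ => hC _ ⟨τ, rfl⟩⟩

noncomputable def PerE.mk {n : ℕ} (g : ℝ → Fin n → ℂ) (hc : Continuous g)
    (hp : ∀ τ, g (τ + 2 * Real.pi) = g τ) : PerE n :=
  ⟨BoundedContinuousFunction.ofNormedAddCommGroup g hc (per_bdd g hc hp).choose
    (per_bdd g hc hp).choose_spec, hp⟩

/-- evaluation -/
noncomputable def PerE.fn {n : ℕ} (f : PerE n) (τ : ℝ) : Fin n → ℂ := f.1 τ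

@[simp] theorem PerE.mk_fn {n : ℕ} (g : ℝ → Fin n → ℂ) (hc : Continuous g)
    (hp : ∀ τ, g (τ + 2 * Real.pi) = g τ) (τ : ℝ) : (PerE.mk g hc hp).fn τ = g τ := rfl
@[simp] theorem PerE.add_fn {n : ℕ} (f g : PerE n) (τ : ℝ) :
  (f + g).fn τ = f.fn τ + g.fn τ := rfl
@[simp] theorem PerE.sub_fn {n : ℕ} (f g : PerE n) (τ : ℝ) :
  (f - g).fn τ = f.fn τ - g.fn τ := rfl
@[simp] theorem PerE.zero_fn {n : ℕ} (τ : ℝ) :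
  (0 : PerE n).fn τ = 0 := rfl
@[simp] theorem PerE.smul_fn {n : ℕ} (c : ℂ) (f : PerE n) (τ : ℝ) :
  (c • f).fn τ = c • f.fn τ := rfl
@[simp] theorem PerE.sum_fn {n : ℕ} {ι : Type*} (S : Finset ι) (f : ι → PerE n) (τ : ℝ) :
    (∑ i ∈ S, f i).fn τ = ∑ i ∈ S, (f i).fn τ := by
  classical
  induction S using Finset.induction_on with
  | empty => simp
  | insert a s ha ih => rw [Finset.sum_insert ha, Finset.sum_insert ha, PerE.add_fn, ih]

theorem PerE.ext {n : ℕ} {f g : PerE n} (h : ∀ τ, f.fn τ = g.fn τ) : f = g :=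
  Subtype.ext (BoundedContinuousFunction.ext h)

theorem PerE.cont {n : ℕ} (f : PerE n) : Continuous f.fn := f.1.continuous
theorem PerE.per {n : ℕ} (f : PerE n) : Function.Periodic f.fn (2 * Real.pi) := f.2
theorem PerE.fn_le {n : ℕ} (f : PerE n) (τ : ℝ) : ‖f.fn τ‖ ≤ ‖f‖ := f.1.norm_coe_le_norm τ
theorem PerE.norm_le {n : ℕ} (f : PerE n) (C : ℝ) (hC : 0 ≤ C) (h : ∀ τ, ‖f.fn τ‖ ≤ C) :
    ‖f‖ ≤ C := (BoundedContinuousFunction.norm_le hC).2 h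
theorem PerE.int {n : ℕ} (f : PerE n) (a b : ℝ) :
    IntervalIntegrable f.fn MeasureTheory.volume a b := f.cont.intervalIntegrable _ _

noncomputable def evE {n : ℕ} (τ : ℝ) : PerE n →L[ℂ] (Fin n → ℂ) :=
  LinearMap.mkContinuous
   ({ toFun := fun f => f.fn τ, map_add' := fun f g => rfl, map_smul' := fun c f => rfl } :
      PerE n →ₗ[ℂ] (Fin n → ℂ)) 1
    (by intro f; rw [one_mul]; exact f.fn_le τ)
@[simp] theorem evE_apply {n : ℕ} (τ : ℝ) (f : PerE n) : evE τ f = f.fn τ := rfl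

noncomputable def constE {n : ℕ} : (Fin n → ℂ) →L[ℂ] PerE n :=
  LinearMap.mkContinuous
   ({ toFun := fun v => PerE.mk (fun _ => v) continuous_const (fun _ => rfl),
      map_add' := fun f g => rfl, map_smul' := fun c f => rfl } : (Fin n → ℂ) →ₗ[ℂ] PerE n) 1
    (by intro f; rw [one_mul]; exact PerE.norm_le _ _ (norm_nonneg _) (fun τ => le_rfl))
@[simp] theorem constE_fn {n : ℕ} (v : Fin n → ℂ) (τ : ℝ) : (constE v).fn τ = v := rfl

noncomputable def meanE {n : ℕ} : PerE n →L[ℂ] (Fin n → ℂ) :=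
  LinearMap.mkContinuous
   ({ toFun := fun f => ((2 * Real.pi : ℝ) : ℂ)⁻¹ • ∫ τ in (0 : ℝ)..(2 * Real.pi), f.fn τ,
      map_add' := fun f g => by
        simp only [PerE.add_fn]
        rw [intervalIntegral.integral_add (f.int _ _) (g.int _ _), smul_add],
      map_smul' := fun c f => by
        simp only [PerE.smul_fn, RingHom.id_apply]
        rw [intervalIntegral.integral_smul, smul_comm] } : PerE n →ₗ[ℂ] (Fin n → ℂ)) 1
    (by
      intro f
      rw [one_mul]
      have hpi := Real.pi_pos
      have := intervalIntegral.norm_integral_le_of_norm_le_const (a := 0) (b := 2 * Real.pi)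
        (f := f.fn) (C := ‖f‖) (fun x _ => f.fn_le x)
      simp only [LinearMap.coe_mk, AddHom.coe_mk]
      rw [norm_smul, norm_inv, Complex.norm_real, Real.norm_of_nonneg (by positivity)]
      rw [sub_zero, abs_of_pos (by positivity)] at this
      rw [inv_mul_le_iff₀ (by positivity)]
      linarith)
theorem meanE_apply {n : ℕ} (f : PerE n) :
  meanE f = ((2 * Real.pi : ℝ) : ℂ)⁻¹ • ∫ τ in (0 : ℝ)..(2 * Real.pi), f.fn τ := rfl

theorem meanE_smul {n : ℕ} (f : PerE n) :
    ∫ τ in (0 : ℝ)..(2 * Real.pi), f.fn τ = ((2 * Real.pi : ℝ) : ℂ) • meanE f := by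
  rw [meanE_apply, smul_smul, mul_inv_cancel₀, one_smul]
  exact_mod_cast (by positivity : (2 * Real.pi : ℝ) ≠ 0)

@[simp] theorem mean_const {n : ℕ} (v : Fin n → ℂ) : meanE (constE v) = v := by
  have h : ((2 * Real.pi : ℝ) : ℂ) ≠ 0 := by
    exact_mod_cast (by positivity : (2 * Real.pi : ℝ) ≠ 0)
  rw [meanE_apply]
  simp only [constE_fn, intervalIntegral.integral_const, sub_zero]
  rw [← Complex.coe_smul, smul_smul, inv_mul_cancel₀ h, one_smul]

theorem mean_of_deriv {n : ℕ} (V g : PerE n) (h : ∀ τ, HasDerivAt V.fn (g.fn τ) τ) :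
    meanE g = 0 := by
  rw [meanE_apply, intervalIntegral.integral_eq_sub_of_hasDerivAt (fun x _ => h x) (g.int _ _)]
  have := V.per 0
  rw [zero_add] at this
  rw [this, sub_self, smul_zero]

theorem eq_of_deriv {n : ℕ} (V W g : PerE n) (h : ∀ τ, HasDerivAt V.fn (g.fn τ) τ)
    (h' : ∀ τ, HasDerivAt W.fn (g.fn τ) τ) (hV : meanE V = 0) (hW : meanE W = 0) : V = W := by
  have hd : ∀ τ, HasDerivAt (V - W).fn 0 τ := by
    intro τ
    have := (h τ).sub (h' τ)
    rw [sub_self] at this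
    exact this
  have hc : V - W = constE ((V - W).fn 0) := by
    refine PerE.ext (fun τ => ?_)
    rw [constE_fn]
    exact is_const_of_deriv_eq_zero (fun τ => (hd τ).differentiableAt) (fun τ => (hd τ).deriv) τ 0
  have h0 : meanE (V - W) = 0 := by rw [map_sub, hV, hW, sub_self]
  rw [hc, mean_const] at h0
  rw [h0, map_zero, sub_eq_zero] at hc
  exact hc

noncomputable def primE {n : ℕ} : PerE n →L[ℂ] PerE n :=
  LinearMap.mkContinuous
   ({ toFun := fun g => PerE.mk (fun τ => ∫ u in (0 : ℝ)..τ, (g - constE (meanE g)).fn u)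
        (intervalIntegral.continuous_primitive (fun a b => PerE.int _ a b) 0)
        (by
          intro τ
          have h0 : ∫ u in (0 : ℝ)..(2 * Real.pi), (g - constE (meanE g)).fn u = 0 := by
            rw [meanE_smul, map_sub, mean_const, sub_self, smul_zero]
          rw [← intervalIntegral.integral_add_adjacent_intervals (b := τ) (PerE.int _ _ _)
            (PerE.int _ _ _), (PerE.per _).intervalIntegral_add_eq τ 0, zero_add, h0, add_zero]),
      map_add' := fun f g => by
        refine PerE.ext (fun τ => ?_)
        simp only [PerE.mk_fn, PerE.add_fn]
        rw [← intervalIntegral.integral_add (PerE.int _ _ _) (PerE.int _ _ _)]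
        congr 1
        ext1 u
        simp only [PerE.add_fn, PerE.sub_fn, map_add, constE_fn]
        abel,
      map_smul' := fun c f => by
        refine PerE.ext (fun τ => ?_)
        simp only [PerE.mk_fn, PerE.smul_fn, RingHom.id_apply]
        rw [← intervalIntegral.integral_smul]
        congr 1
        ext1 u
        simp only [PerE.smul_fn, PerE.sub_fn, map_smul, constE_fn, smul_sub] } :
      PerE n →ₗ[ℂ] PerE n)
    (‖ContinuousLinearMap.id ℂ (PerE n) - constE ∘L meanE‖ * (2 * Real.pi))
    (by
      intro g
      have hpi := Real.pi_pos
      apply PerE.norm_le _ _ (by positivity)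
      intro τ
      obtain ⟨y, hy, hy'⟩ := (PerE.per (_ : PerE n)).exists_mem_Ico₀ (f := PerE.fn _)
        (by positivity : 0 < 2 * Real.pi) τ
      rw [hy']
      simp only [LinearMap.coe_mk, AddHom.coe_mk, PerE.mk_fn]
      have h1 : ‖g - constE (meanE g)‖ ≤
          ‖ContinuousLinearMap.id ℂ (PerE n) - constE ∘L meanE‖ * ‖g‖ := by
        have := (ContinuousLinearMap.id ℂ (PerE n) - constE ∘L meanE).le_opNorm g
        simpa using this
      have := intervalIntegral.norm_integral_le_of_norm_le_const (a := 0) (b := y)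
        (f := (g - constE (meanE g)).fn) (C := ‖g - constE (meanE g)‖) (fun x _ => PerE.fn_le _ x)
      refine this.trans ?_
      rw [sub_zero, abs_of_nonneg hy.1, mul_right_comm]
      exact mul_le_mul h1 hy.2.le hy.1 (by positivity))

theorem primE_deriv {n : ℕ} (g : PerE n) (τ : ℝ) :
    HasDerivAt (primE g).fn ((g - constE (meanE g)).fn τ) τ :=
  intervalIntegral.integral_hasDerivAt_right (PerE.int _ _ _)
    ((PerE.cont _).stronglyMeasurableAtFilter _ _) (PerE.cont _).continuousAt

noncomputable def JE {n : ℕ} : PerE n →L[ℂ] PerE n := (primE (n := n)) - (constE (n := n)) ∘L (meanE (n := n)) ∘L (primE (n := n))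

@[simp] theorem mean_JE {n : ℕ} (g : PerE n) : meanE (JE g) = 0 := by
  simp [JE]

theorem JE_deriv {n : ℕ} (g : PerE n) (τ : ℝ) :
    HasDerivAt (JE g).fn ((g - constE (meanE g)).fn τ) τ := by
  have := (primE_deriv g τ).sub_const (meanE (primE g))
  exact this

theorem JE_unique {n : ℕ} (V g : PerE n) (hV : meanE V = 0)
    (h : ∀ τ, HasDerivAt V.fn (g.fn τ) τ) : meanE g = 0 ∧ V = JE g := by
  have h0 := mean_of_deriv V g h
  refine ⟨h0, eq_of_deriv V (JE g) g h (fun τ => ?_) hV (mean_JE g)⟩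
  have := JE_deriv g τ
  rwa [h0, map_zero, sub_zero] at this

@[simp] theorem JE_const {n : ℕ} (v : Fin n → ℂ) : JE (constE v) = 0 := by
  refine eq_of_deriv _ 0 0 (fun τ => ?_) (fun τ => ?_) (mean_JE _) (map_zero _)
  · have := JE_deriv (constE v) τ
    rwa [mean_const, sub_self] at this
  · exact hasDerivAt_const _ _

/-- multiplication by `e^{ilτ} B` -/
noncomputable def modeE {n : ℕ} (l : ℤ) (B : Matrix (Fin n) (Fin n) ℂ) : PerE n →L[ℂ] PerE n :=
  LinearMap.mkContinuous
   ({ toFun := fun f => PerE.mk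
        (fun τ => Complex.exp (Complex.I * (l : ℂ) * (τ : ℂ)) • B.mulVec (f.fn τ))
        (by
          have := f.cont
          have h1 : Continuous (fun τ : ℝ => Complex.exp (Complex.I * (l : ℂ) * (τ : ℂ))) := by
            fun_prop
          exact h1.smul (Continuous.matrix_mulVec continuous_const this))
        (by
          intro τ
          rw [f.per τ]
          congr 1
          rw [Complex.exp_eq_exp_iff_exists_int]
          exact ⟨l, by push_cast; ring⟩),
      map_add' := fun f g => by
        refine PerE.ext (fun τ => ?_)
        simp only [PerE.mk_fn, PerE.add_fn, Matrix.mulVec_add, smul_add],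
      map_smul' := fun c f => by
        refine PerE.ext (fun τ => ?_)
        simp only [PerE.mk_fn, PerE.smul_fn, Matrix.mulVec_smul, RingHom.id_apply]
        rw [smul_comm] } : PerE n →ₗ[ℂ] PerE n)
    ‖(Matrix.mulVecLin B).toContinuousLinearMap‖
    (by
      intro f
      apply PerE.norm_le _ _ (by positivity)
      intro τ
      simp only [LinearMap.coe_mk, AddHom.coe_mk, PerE.mk_fn]
      have h1 : ‖Complex.exp (Complex.I * (l : ℂ) * (τ : ℂ))‖ = 1 := by
        have : Complex.I * (l : ℂ) * (τ : ℂ) = ((l * τ : ℝ) : ℂ) * Complex.I := by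
          push_cast; ring
        rw [this, Complex.norm_exp_ofReal_mul_I]
      rw [norm_smul, h1, one_mul]
      exact (Matrix.mulVecLin B).toContinuousLinearMap.le_opNorm_of_le (f.fn_le τ))

@[simp] theorem modeE_fn {n : ℕ} (l : ℤ) (B : Matrix (Fin n) (Fin n) ℂ) (f : PerE n) (τ : ℝ) :
    (modeE l B f).fn τ =
      Complex.exp (Complex.I * (l : ℂ) * (τ : ℂ)) • B.mulVec (f.fn τ) := rfl

theorem modeE_comp {n : ℕ} (k l : ℤ) (A B : Matrix (Fin n) (Fin n) ℂ) (f : PerE n) :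
    modeE k A (modeE l B f) = modeE (k + l) (A * B) f := by
  refine PerE.ext (fun τ => ?_)
  simp only [modeE_fn, Matrix.mulVec_smul, smul_smul, Matrix.mulVec_mulVec, ← Complex.exp_add]
  congr 2
  push_cast; ring

@[simp] theorem modeE_zero_const {n : ℕ} (B : Matrix (Fin n) (Fin n) ℂ) (v : Fin n → ℂ) :
    modeE 0 B (constE v) = constE (B.mulVec v) := by
  refine PerE.ext (fun τ => ?_)
  simp

theorem modeE_deriv {n : ℕ} (l : ℤ) (hl : l ≠ 0) (B : Matrix (Fin n) (Fin n) ℂ)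
    (v : Fin n → ℂ) (τ : ℝ) :
    HasDerivAt ((Complex.I * (l : ℂ))⁻¹ • modeE l B (constE v)).fn
      ((modeE l B (constE v)).fn τ) τ := by
  have hl' : Complex.I * (l : ℂ) ≠ 0 := by simp [hl]
  have h1 : HasDerivAt (fun τ : ℝ => Complex.exp (Complex.I * (l : ℂ) * (τ : ℂ)))
      (Complex.exp (Complex.I * (l : ℂ) * (τ : ℂ)) * (Complex.I * (l : ℂ))) τ := by
    have := (((hasDerivAt_id (τ : ℂ)).const_mul (Complex.I * (l : ℂ))).cexp).comp_ofReal
    simpa using this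
  have h2 := (h1.smul_const (B.mulVec v)).const_smul ((Complex.I * (l : ℂ))⁻¹)
  have e : (modeE l B (constE v)).fn τ = (Complex.I * (l : ℂ))⁻¹ •
     (Complex.exp (Complex.I * (l : ℂ) * (τ : ℂ)) * (Complex.I * (l : ℂ))) • B.mulVec v := by
    rw [smul_smul, modeE_fn, constE_fn]
    congr 1
    field_simp
  rw [e]
  exact h2

theorem mean_mode_const {n : ℕ} (l : ℤ) (hl : l ≠ 0) (B : Matrix (Fin n) (Fin n) ℂ)
    (v : Fin n → ℂ) : meanE (modeE l B (constE v)) = 0 :=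
  mean_of_deriv _ _ (modeE_deriv l hl B v)

theorem JE_mode_const {n : ℕ} (l : ℤ) (hl : l ≠ 0) (B : Matrix (Fin n) (Fin n) ℂ)
    (v : Fin n → ℂ) :
    JE (modeE l B (constE v)) = (Complex.I * (l : ℂ))⁻¹ • modeE l B (constE v) := by
  refine ((JE_unique _ _ ?_ (modeE_deriv l hl B v)).2).symm
  rw [map_smul, mean_mode_const l hl, smul_zero]

theorem mean_mode_zero {n : ℕ} (B : Matrix (Fin n) (Fin n) ℂ) (f : PerE n) :
    meanE (modeE 0 B f) = B.mulVec (meanE f) := by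
  rw [meanE_apply, meanE_apply, Matrix.mulVec_smul]
  congr 1
  have := (Matrix.mulVecLin B).toContinuousLinearMap.intervalIntegral_comp_comm (f.int 0 (2 * Real.pi))
  simpa using this


/-! ### The linear algebra -/

noncomputable def aLin {n s : ℕ} (a : Fin s → Fin n → ℂ) : (Fin s → ℂ) →L[ℂ] (Fin n → ℂ) :=
  LinearMap.toContinuousLinearMap (Fintype.linearCombination ℂ a)

theorem aLin_apply {n s : ℕ} (a : Fin s → Fin n → ℂ) (μ : Fin s → ℂ) :
    aLin a μ = ∑ j, μ j • a j := by
  simp [aLin, Fintype.linearCombination_apply]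

noncomputable def matL {n : ℕ} (B : Matrix (Fin n) (Fin n) ℂ) : (Fin n → ℂ) →L[ℂ] (Fin n → ℂ) :=
  LinearMap.toContinuousLinearMap (Matrix.mulVecLin B)

theorem matL_apply {n : ℕ} (B : Matrix (Fin n) (Fin n) ℂ) (v : Fin n → ℂ) :
    matL B v = B.mulVec v := rfl

theorem exists_S {n s : ℕ} (A₀ A₁ : Matrix (Fin n) (Fin n) ℂ) (a : Fin s → Fin n → ℂ)
    (ha_indep : LinearIndependent ℂ a)
    (ha_span : ∀ v : Fin n → ℂ, A₀.mulVec v = 0 → v ∈ Submodule.span ℂ (Set.range a))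
    (hnodeg : ∀ μ : Fin s → ℂ, μ ≠ 0 →
      ∀ x : Fin n → ℂ, A₀.mulVec x + A₁.mulVec (∑ j, μ j • a j) ≠ 0) :
    ∃ (p : (Fin n → ℂ) →ₗ[ℂ] (Fin s → ℂ)) (S₁ : (Fin n → ℂ) →L[ℂ] (Fin n → ℂ))
      (S₂ : (Fin n → ℂ) →L[ℂ] (Fin s → ℂ)), (∀ μ, p (aLin a μ) = μ) ∧
      ∀ W μ, p W = 0 → S₁ (A₀.mulVec W + A₁.mulVec (aLin a μ)) = W ∧
        S₂ (A₀.mulVec W + A₁.mulVec (aLin a μ)) = μ := by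
  have hinj : LinearMap.ker (Fintype.linearCombination ℂ a) = ⊥ := by
    rw [LinearMap.ker_eq_bot]
    exact LinearIndependent.fintypeLinearCombination_injective ha_indep
  obtain ⟨p, hp⟩ := LinearMap.exists_leftInverse_of_injective _ hinj
  have hp' : ∀ μ, p (aLin a μ) = μ := fun μ => LinearMap.congr_fun hp μ
  let Φ : ((Fin n → ℂ) × (Fin s → ℂ)) →ₗ[ℂ] ((Fin n → ℂ) × (Fin s → ℂ)) :=
    LinearMap.prod
      (A₀.mulVecLin ∘ₗ LinearMap.fst ℂ _ _ +
        A₁.mulVecLin ∘ₗ (aLin a).toLinearMap ∘ₗ LinearMap.snd ℂ _ _)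
      (p ∘ₗ LinearMap.fst ℂ _ _)
  have hΦ : ∀ W μ, Φ (W, μ) = (A₀.mulVec W + A₁.mulVec (aLin a μ), p W) := fun W μ => rfl
  have hΦinj : LinearMap.ker Φ = ⊥ := by
    rw [LinearMap.ker_eq_bot']
    rintro ⟨W, μ⟩ h
    rw [hΦ, Prod.mk_eq_zero] at h
    obtain ⟨h1, h2⟩ := h
    have hμ : μ = 0 := by
      by_contra hne
      rw [aLin_apply] at h1
      exact hnodeg μ hne W h1
    rw [hμ, map_zero, Matrix.mulVec_zero, add_zero] at h1
    have := ha_span W h1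
    rw [Submodule.mem_span_range_iff_exists_fun] at this
    obtain ⟨c, hc⟩ := this
    rw [← aLin_apply] at hc
    have hc0 : c = 0 := by rw [← hp' c, hc, h2]
    rw [hc0, map_zero] at hc
    rw [← hc, hμ]
    rfl
  obtain ⟨S, hS⟩ := LinearMap.exists_leftInverse_of_injective _ hΦinj
  refine ⟨p, LinearMap.toContinuousLinearMap
    (LinearMap.fst ℂ _ _ ∘ₗ S ∘ₗ LinearMap.inl ℂ (Fin n → ℂ) (Fin s → ℂ)),
    LinearMap.toContinuousLinearMap
    (LinearMap.snd ℂ _ _ ∘ₗ S ∘ₗ LinearMap.inl ℂ (Fin n → ℂ) (Fin s → ℂ)), hp', ?_⟩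
  intro W μ hW
  have h := LinearMap.congr_fun hS (W, μ)
  rw [LinearMap.comp_apply, hΦ, hW, LinearMap.id_apply] at h
  have e1 : ∀ v, (LinearMap.inl ℂ (Fin n → ℂ) (Fin s → ℂ)) v = (v, 0) := fun v => rfl
  constructor
  · simp only [LinearMap.coe_toContinuousLinearMap', LinearMap.comp_apply, e1, h,
      LinearMap.fst_apply]
  · simp only [LinearMap.coe_toContinuousLinearMap', LinearMap.comp_apply, e1, h,
      LinearMap.snd_apply]

/-! ### The oscillating operator -/

noncomputable def NE {n : ℕ} (m : ℕ) (B : ℤ → Matrix (Fin n) (Fin n) ℂ) : PerE n →L[ℂ] PerE n :=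
  ∑ l ∈ (Finset.Icc (-(m : ℤ)) (m : ℤ)).erase 0, modeE l (B l)

theorem NE_apply {n : ℕ} (m : ℕ) (B : ℤ → Matrix (Fin n) (Fin n) ℂ) (f : PerE n) :
    NE m B f = ∑ l ∈ (Finset.Icc (-(m : ℤ)) (m : ℤ)).erase 0, modeE l (B l) f := by
  simp [NE]

theorem mean_NE_const {n : ℕ} (m : ℕ) (B : ℤ → Matrix (Fin n) (Fin n) ℂ) (v : Fin n → ℂ) :
    meanE (NE m B (constE v)) = 0 := by
  rw [NE_apply, map_sum]
  exact Finset.sum_eq_zero (fun l hl => mean_mode_const l (Finset.ne_of_mem_erase hl) _ _)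

theorem mean_NJN {n : ℕ} (m : ℕ) (B : ℤ → Matrix (Fin n) (Fin n) ℂ) (v : Fin n → ℂ) :
    meanE (NE m B (JE (NE m B (constE v)))) =
      (∑ l ∈ (Finset.Icc (-(m : ℤ)) (m : ℤ)).erase 0,
        (Complex.I * (l : ℂ))⁻¹ • (B (-l) * B l)).mulVec v := by
  rw [NE_apply m B (constE v), map_sum, map_sum, map_sum, Matrix.sum_mulVec]
  refine Finset.sum_congr rfl (fun l hl => ?_)
  rw [JE_mode_const l (Finset.ne_of_mem_erase hl), map_smul, map_smul, Matrix.smul_mulVec,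
    NE_apply, map_sum]
  congr 1
  rw [Finset.sum_eq_single (-l)]
  · rw [modeE_comp, neg_add_cancel, modeE_zero_const, mean_const]
  · intro k _ hk
    rw [modeE_comp, mean_mode_const]
    intro h
    exact hk (eq_neg_of_add_eq_zero_left h)
  · intro h
    exfalso
    apply h
    simp only [Finset.mem_erase, Finset.mem_Icc] at hl ⊢
    omega

noncomputable def dE {n : ℕ} (m : ℕ) (d : ℤ → Fin n → ℂ) : PerE n :=
  constE (d 0) + ∑ l ∈ (Finset.Icc (-(m : ℤ)) (m : ℤ)).erase 0, modeE l 1 (constE (d l))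

theorem mean_dE {n : ℕ} (m : ℕ) (d : ℤ → Fin n → ℂ) : meanE (dE m d) = d 0 := by
  rw [dE, map_add, mean_const, map_sum, Finset.sum_eq_zero, add_zero]
  exact (fun l hl => mean_mode_const l (Finset.ne_of_mem_erase hl) _ _)

/-! ### The series for the periodic solution -/

theorem main_exp {n m s : ℕ}
    (A₀ : Matrix (Fin n) (Fin n) ℂ)
    (B : ℤ → Matrix (Fin n) (Fin n) ℂ)
    (d : ℤ → Fin n → ℂ)
    (a : Fin s → Fin n → ℂ)
    (ha_indep : LinearIndependent ℂ a)
    (ha_ker : ∀ j, A₀.mulVec (a j) = 0)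
    (ha_span : ∀ v : Fin n → ℂ, A₀.mulVec v = 0 → v ∈ Submodule.span ℂ (Set.range a))
    (A₁ : Matrix (Fin n) (Fin n) ℂ)
    (hA₁ : A₁ = B 0 + ∑ l ∈ (Finset.Icc (-(m : ℤ)) (m : ℤ)).erase 0,
        (Complex.I * (l : ℂ))⁻¹ • (B (-l) * B l))
    (hnodeg : ∀ μ : Fin s → ℂ, μ ≠ 0 →
      ∀ x : Fin n → ℂ, A₀.mulVec x + A₁.mulVec (∑ j, μ j • a j) ≠ 0) :
    ∃ (u : ℕ → (Fin n → ℂ) × (Fin s → ℂ) × PerE n) (K ρ : ℝ), 0 < K ∧ 1 ≤ ρ ∧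
      (∀ k, ‖u k‖ ≤ K * ρ ^ k) ∧ (∀ k, meanE (u k).2.2 = 0) ∧
      ∀ ω : ℝ, 2 * ρ < ω → ∀ x : ℝ → Fin n → ℂ,
          (ContDiff ℝ 1 x ∧
           (∀ t : ℝ, x (t + 2 * Real.pi / ω) = x t) ∧
           (∀ t : ℝ, deriv x t =
             (A₀ + ((ω : ℂ))⁻¹ • B 0).mulVec (x t)
             + ∑ l ∈ (Finset.Icc (-(m : ℤ)) (m : ℤ)).erase 0,
                 Complex.exp (Complex.I * (l : ℂ) * (ω : ℂ) * (t : ℂ)) •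
                   ((B l).mulVec (x t) + d l)
             + d 0)) →
        ∃ v : (Fin n → ℂ) × (Fin s → ℂ) × PerE n,
          (∀ t, x t = (ω : ℂ) • aLin a v.2.1 + v.1 + v.2.2.fn (ω * t)) ∧
          Filter.Tendsto (fun r => ∑ k ∈ Finset.range r, ((ω : ℂ)⁻¹) ^ k • u k)
            Filter.atTop (nhds v) := by
  obtain ⟨p, S₁, S₂, hp, hS⟩ := exists_S A₀ A₁ a ha_indep ha_span hnodeg
  have hA₀a : ∀ μ, A₀.mulVec (aLin a μ) = 0 := by
    intro μ
    rw [aLin_apply, Matrix.mulVec_sum]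
    refine Finset.sum_eq_zero (fun j _ => ?_)
    rw [Matrix.mulVec_smul, ha_ker, smul_zero]
  let U := (Fin n → ℂ) × (Fin s → ℂ) × PerE n
  let N := NE m B
  let sW : U →L[ℂ] (Fin n → ℂ) := ContinuousLinearMap.fst ℂ _ _
  let sV : U →L[ℂ] PerE n :=
    (ContinuousLinearMap.snd ℂ _ _) ∘L (ContinuousLinearMap.snd ℂ _ _)
  let D : ((Fin n → ℂ) × PerE n) →L[ℂ] U :=
    (S₁ ∘L ContinuousLinearMap.fst ℂ _ _).prod ((S₂ ∘L ContinuousLinearMap.fst ℂ _ _).prod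
      (JE ∘L N ∘L constE ∘L aLin a ∘L S₂ ∘L ContinuousLinearMap.fst ℂ _ _ +
        ContinuousLinearMap.snd ℂ _ _))
  have hD : ∀ q g, D (q, g) = (S₁ q, S₂ q, JE (N (constE (aLin a (S₂ q)))) + g) :=
    fun q g => rfl
  let G₁ : U →L[ℂ] PerE n := JE ∘L (modeE 0 A₀ ∘L sV + N ∘L (constE ∘L sW + sV))
  have hG₁ : ∀ v, G₁ v = JE (modeE 0 A₀ v.2.2 + N (constE v.1 + v.2.2)) := fun v => rfl
  let G₂ : U →L[ℂ] PerE n := JE ∘L modeE 0 (B 0) ∘L sV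
  have hG₂ : ∀ v, G₂ v = JE (modeE 0 (B 0) v.2.2) := fun v => rfl
  let H₁ : U →L[ℂ] (Fin n → ℂ) := - (matL (B 0) ∘L sW) - meanE ∘L N ∘L G₁
  have hH₁ : ∀ v, H₁ v = - (B 0).mulVec v.1 - meanE (N (G₁ v)) := fun v => rfl
  let H₂ : U →L[ℂ] (Fin n → ℂ) := - (meanE ∘L N ∘L G₂)
  have hH₂ : ∀ v, H₂ v = - meanE (N (G₂ v)) := fun v => rfl
  let T₁ : U →L[ℂ] U := D ∘L (H₁.prod G₁)
  let T₂ : U →L[ℂ] U := D ∘L (H₂.prod G₂)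
  have hT₁ : ∀ v, T₁ v = D (H₁ v, G₁ v) := fun v => rfl
  have hT₂ : ∀ v, T₂ v = D (H₂ v, G₂ v) := fun v => rfl
  let f := JE (dE m d)
  let b₀ : U := D (- d 0, 0)
  let b₁ : U := D (- meanE (N f), f)
  have hDmean : ∀ q g, meanE g = 0 → meanE (D (q, g)).2.2 = 0 := by
    intro q g hg
    rw [hD]
    simp only [map_add, mean_JE, hg, add_zero]
  refine ⟨useq T₁ T₂ b₀ b₁, _, _, ?_, ?_, useq_bound T₁ T₂ b₀ b₁, ?_, ?_⟩
  · positivity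
  · have := norm_nonneg T₁
    have := norm_nonneg T₂
    linarith
  · let P : Submodule ℂ U := LinearMap.ker (meanE ∘L sV : U →L[ℂ] (Fin n → ℂ)).toLinearMap
    have hP : ∀ v : U, v ∈ P ↔ meanE v.2.2 = 0 := fun v => Iff.rfl
    intro k
    rw [← hP]
    apply useq_mem
    · exact hDmean _ _ (map_zero _)
    · exact hDmean _ _ (mean_JE _)
    · exact fun v => hDmean _ _ (mean_JE _)
    · exact fun v => hDmean _ _ (mean_JE _)
  · rintro ω hω x ⟨hx1, hx2, hx3⟩
    have hω0 : 0 < ω := by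
      have := norm_nonneg T₁
      have := norm_nonneg T₂
      linarith
    have hωC : (ω : ℂ) ≠ 0 := by exact_mod_cast hω0.ne'
    set ε : ℂ := (ω : ℂ)⁻¹ with hε
    have hεω : ε * ω = 1 := inv_mul_cancel₀ hωC
    -- the rescaled solution
    let X : PerE n := PerE.mk (fun τ => x (τ / ω)) (hx1.continuous.comp (by fun_prop))
      (by intro τ; rw [add_div]; exact hx2 _)
    have hX : ∀ τ, X.fn τ = x (τ / ω) := fun τ => rfl
    let μ : Fin s → ℂ := ε • p (meanE X)
    let W : Fin n → ℂ := meanE X - (ω : ℂ) • aLin a μ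
    let V : PerE n := X - constE (meanE X)
    have hpW : p W = 0 := by
      simp only [W, μ, map_sub, map_smul, hp, smul_smul]
      rw [mul_comm, hεω, one_smul, sub_self]
    have hmX : meanE X = (ω : ℂ) • aLin a μ + W := by simp only [W]; abel
    have hXV : X = constE ((ω : ℂ) • aLin a μ + W) + V := by
      rw [← hmX]; simp only [V]; abel
    have hmV : meanE V = 0 := by simp only [V, map_sub, mean_const, sub_self]
    clear_value W μ
    -- right-hand side
    let g : PerE n := ε • (modeE 0 A₀ X + ε • modeE 0 (B 0) X + N X + dE m d)
    have hgd : ∀ τ, HasDerivAt V.fn (g.fn τ) τ := by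
      intro τ
      have h1 : HasDerivAt x (deriv x (τ / ω)) (τ / ω) :=
        (hx1.differentiable (by norm_num) _).hasDerivAt
      have h2 : HasDerivAt (fun τ : ℝ => τ / ω) (1 / ω) τ := (hasDerivAt_id τ).div_const ω
      have h3 := (h1.scomp τ h2).sub_const (meanE X)
      have e : g.fn τ = (1 / ω) • deriv x (τ / ω) := by
        rw [hx3, ← Complex.coe_smul]
        have e1 : ∀ l : ℤ, Complex.I * (l : ℂ) * (ω : ℂ) * ((τ / ω : ℝ) : ℂ) =
            Complex.I * (l : ℂ) * (τ : ℂ) := by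
          intro l; push_cast; field_simp
        simp only [e1]
        have e2 : ((1 / ω : ℝ) : ℂ) = ε := by rw [hε]; push_cast; rw [one_div]
        rw [e2]
        simp only [g, N, NE_apply, dE, PerE.smul_fn, PerE.add_fn, PerE.sum_fn, modeE_fn, hX,
          constE_fn, Matrix.one_mulVec, Matrix.add_mulVec, Matrix.smul_mulVec, smul_add,
          Finset.sum_add_distrib, Int.cast_zero, mul_zero, zero_mul, Complex.exp_zero, one_smul]
        abel
      rw [e]
      exact h3
    obtain ⟨hg0, hVg⟩ := JE_unique V g hmV hgd
    -- rewrite the right-hand side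
    have hg : g = N (constE (aLin a μ)) + constE (ε • ((A₀.mulVec W) + ε • ((B 0).mulVec W) +
        (B 0).mulVec (aLin a μ))) +
        ε • ((modeE 0 A₀ V + N (constE W + V) + dE m d) + ε • modeE 0 (B 0) V) := by
      have ea : ∀ z : PerE n, ε • (ω : ℂ) • z = z := by
        intro z; rw [smul_smul, hεω, one_smul]
      simp only [g]
      rw [hXV]
      simp only [map_add, map_smul, modeE_zero_const, Matrix.mulVec_add, Matrix.mulVec_smul, hA₀a,
        smul_zero, map_zero, zero_add, smul_add, ea]
      abel
    have hmean : A₀.mulVec W + (B 0).mulVec (aLin a μ) + meanE (N V) + d 0 +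
        ε • (B 0).mulVec W = 0 := by
      have hε0 : ε ≠ 0 := inv_ne_zero hωC
      rw [hg] at hg0
      simp only [map_add, map_smul, mean_const, N, mean_NE_const, mean_mode_zero, hmV, mean_dE,
        Matrix.mulVec_zero, smul_zero, zero_add, add_zero] at hg0
      rw [← smul_add, smul_eq_zero_iff_right hε0] at hg0
      rw [← hg0]
      abel
    set v : U := (W, μ, V) with hv
    let G : PerE n := G₁ v + f + ε • G₂ v
    have hVG : V = JE (N (constE (aLin a μ))) + ε • G := by
      rw [hg] at hVg
      simp only [map_add, map_smul, JE_const, add_zero, smul_zero] at hVg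
      simp only [G, hG₁, hG₂, f, v, map_add]
      conv_lhs => rw [hVg]
    let q : Fin n → ℂ := - d 0 + ε • (- meanE (N f)) + ε • H₁ v + ε ^ 2 • H₂ v
    have hq : A₀.mulVec W + A₁.mulVec (aLin a μ) = q := by
      have h1 : meanE (N V) = A₁.mulVec (aLin a μ) - (B 0).mulVec (aLin a μ) +
          ε • meanE (N G) := by
        conv_lhs => rw [hVG]
        rw [map_add, map_add, map_smul, map_smul]
        simp only [N]
        rw [mean_NJN, hA₁, Matrix.add_mulVec, add_sub_cancel_left]
      rw [h1] at hmean
      have h2 : meanE (N G) = meanE (N (G₁ v)) + meanE (N f) + ε • meanE (N (G₂ v)) := by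
        simp only [G, map_add, map_smul]
      rw [h2] at hmean
      simp only [q, hH₁, hH₂, v]
      rw [← sub_eq_zero, ← hmean]
      module
    refine ⟨v, ?_, ?_⟩
    · intro t
      have := hX (ω * t)
      rw [mul_div_cancel_left₀ _ hω0.ne'] at this
      have h6 := congrArg (fun z => PerE.fn z (ω * t)) hXV
      simp only [PerE.add_fn, constE_fn] at h6
      exact this.symm.trans h6
    · apply useq_tendsto
      · rw [hε, norm_inv, Complex.norm_real, Real.norm_of_nonneg hω0.le, inv_mul_le_iff₀ hω0]
        linarith
      · have h3 : v = D (q, ε • G) := by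
          obtain ⟨h4, h5⟩ := hS W μ hpW
          rw [hq] at h4 h5
          rw [hD, h4, h5, ← hVG]
        conv_lhs => rw [h3]
        rw [hT₁, hT₂]
        simp only [b₀, b₁]
        rw [← map_smul, ← map_smul, ← map_smul, ← map_add, ← map_add, ← map_add]
        congr 1
        simp only [Prod.smul_mk, Prod.mk_add_mk, q, G]
        congr 1
        module


theorem euclNorm_le {n : ℕ} (v : Fin n → ℂ) : euclNorm v ≤ (n + 1) * ‖v‖ := by
  unfold euclNorm
  apply Real.sqrt_le_iff.2
  refine ⟨by positivity, ?_⟩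
  calc ∑ i, ‖v i‖ ^ 2 ≤ ∑ _i : Fin n, ‖v‖ ^ 2 := by
        refine Finset.sum_le_sum (fun i _ => ?_)
        have := norm_le_pi_norm v i
        gcongr
    _ = n * ‖v‖ ^ 2 := by simp
    _ ≤ ((n + 1) * ‖v‖) ^ 2 := by
        rw [mul_pow]
        have : (n : ℝ) ≤ (n + 1) ^ 2 := by
          have : (0 : ℝ) ≤ n := Nat.cast_nonneg n
          nlinarith
        gcongr

theorem stmt_1
    (n m s : ℕ) (hn : 1 ≤ n) (hs : 1 ≤ s) (hsn : s ≤ n)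
    (A₀ : Matrix (Fin n) (Fin n) ℂ)
    (B : ℤ → Matrix (Fin n) (Fin n) ℂ)
    (d : ℤ → Fin n → ℂ)
    (a : Fin s → Fin n → ℂ)
    (ha_indep : LinearIndependent ℂ a)
    (ha_ker : ∀ j, A₀.mulVec (a j) = 0)
    (ha_span : ∀ v : Fin n → ℂ, A₀.mulVec v = 0 → v ∈ Submodule.span ℂ (Set.range a))
    (A₁ : Matrix (Fin n) (Fin n) ℂ)
    (hA₁ : A₁ = B 0 + ∑ l ∈ (Finset.Icc (-(m : ℤ)) (m : ℤ)).erase 0,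
        (Complex.I * (l : ℂ))⁻¹ • (B (-l) * B l))
    (hnodeg : ∀ μ : Fin s → ℂ, μ ≠ 0 →
      ∀ x : Fin n → ℂ, A₀.mulVec x + A₁.mulVec (∑ j, μ j • a j) ≠ 0) :
    ∃ ω₀ : ℝ, 0 < ω₀ ∧ ∃ M₀ : ℝ, 0 < M₀ ∧
    ∃ Cneg : Fin s → ℂ, ∃ C : ℕ → Fin s → ℂ,
    ∃ xv : ℕ → Fin n → ℂ, ∃ y : ℕ → ℝ → Fin n → ℂ,
      (∀ k, Continuous (y k)) ∧
      (∀ k, ∀ τ : ℝ, y k (τ + 2 * Real.pi) = y k τ) ∧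
      (∀ k, ∫ τ in (0 : ℝ)..(2 * Real.pi), y k τ = 0) ∧
      (∀ ω : ℝ, ω₀ < ω →
        ∀ x : ℝ → Fin n → ℂ,
          (ContDiff ℝ 1 x ∧
           (∀ t : ℝ, x (t + 2 * Real.pi / ω) = x t) ∧
           (∀ t : ℝ, deriv x t =
             (A₀ + ((ω : ℂ))⁻¹ • B 0).mulVec (x t)
             + ∑ l ∈ (Finset.Icc (-(m : ℤ)) (m : ℤ)).erase 0,
                 Complex.exp (Complex.I * (l : ℂ) * (ω : ℂ) * (t : ℂ)) •
                   ((B l).mulVec (x t) + d l)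
             + d 0)) →
          -- the series converges (pointwise) to `x(t)`
          (∀ t : ℝ, HasSum
            (fun k : ℕ => ((ω : ℂ)⁻¹) ^ k •
              (xv k + y k (ω * t) + ∑ j, C k j • a j))
            (x t - (ω : ℂ) • ∑ j, Cneg j • a j)) ∧
          -- the convergence is absolute and uniform in `t ∈ ℝ` (Weierstrass test)
          (∃ g : ℕ → ℝ, Summable g ∧ ∀ k : ℕ, ∀ t : ℝ,
            euclNorm (((ω : ℂ)⁻¹) ^ k •
              (xv k + y k (ω * t) + ∑ j, C k j • a j)) ≤ g k) ∧
          -- the asymptotic estimate (3)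
          (∀ r : ℕ, ∀ t : ℝ,
            euclNorm (x t - (ω : ℂ) • (∑ j, Cneg j • a j)
              - ∑ k ∈ Finset.range (r + 1), ((ω : ℂ)⁻¹) ^ k •
                  (xv k + y k (ω * t) + ∑ j, C k j • a j))
              ≤ M₀ ^ (r + 1) / ω ^ (r + 1))) := by
  obtain ⟨u, K, ρ, hK, hρ, hu, hmean, hmain⟩ :=
    main_exp A₀ B d a ha_indep ha_ker ha_span A₁ hA₁ hnodeg
  have hρ0 : 0 < ρ := by linarith
  -- constant bounding the terms
  set c : ℝ := K * (2 + ‖aLin a‖ * ρ) with hc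
  have hc0 : 0 < c := by
    have := norm_nonneg (aLin a)
    positivity
  set M₀ : ℝ := ρ * (1 + 2 * (n + 1) * c) with hM
  have hn0 : (0 : ℝ) ≤ n := Nat.cast_nonneg n
  refine ⟨2 * ρ, by positivity, M₀, by positivity, (u 0).2.1, fun k => (u (k + 1)).2.1,
    fun k => (u k).1, fun k => (u k).2.2.fn, fun k => PerE.cont _, fun k => PerE.per _,
    fun k => by rw [meanE_smul, hmean, smul_zero], ?_⟩
  intro ω hω x hx
  obtain ⟨v, hv, hlim⟩ := hmain ω hω x hx
  have hω0 : 0 < ω := by linarith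
  have hωC : (ω : ℂ) ≠ 0 := by exact_mod_cast hω0.ne'
  simp only [← aLin_apply]
  have hq1 : ρ / ω ≤ 1 / 2 := by rw [div_le_iff₀ hω0]; linarith
  have hq0 : 0 ≤ ρ / ω := by positivity
  -- termwise bound
  have hterm : ∀ t k, ‖((ω : ℂ)⁻¹) ^ k • ((u k).1 + (u k).2.2.fn (ω * t) +
      aLin a (u (k + 1)).2.1)‖ ≤ c * (ρ / ω) ^ k := by
    intro t k
    have h1 : ‖(u k).1‖ ≤ K * ρ ^ k := (norm_fst_le _).trans (hu k)
    have h2 : ‖(u k).2.2.fn (ω * t)‖ ≤ K * ρ ^ k :=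
      (PerE.fn_le _ _).trans (((norm_snd_le _).trans (norm_snd_le _)).trans (hu k))
    have h3 : ‖(u (k + 1)).2.1‖ ≤ K * ρ ^ (k + 1) :=
      ((norm_fst_le _).trans (norm_snd_le _)).trans (hu (k + 1))
    have h4 := (aLin a).le_opNorm_of_le h3
    rw [norm_smul, norm_pow, norm_inv, Complex.norm_real, Real.norm_of_nonneg hω0.le]
    calc _ ≤ ω⁻¹ ^ k * (K * ρ ^ k + K * ρ ^ k + ‖aLin a‖ * (K * ρ ^ (k + 1))) := by
          gcongr
          exact (norm_add_le _ _).trans (add_le_add ((norm_add_le _ _).trans (add_le_add h1 h2)) h4)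
      _ = _ := by rw [hc, div_eq_mul_inv, mul_pow]; ring
  have hgeo : Summable (fun k : ℕ => c * (ρ / ω) ^ k) :=
    (summable_geometric_of_lt_one hq0 (by linarith)).mul_left c
  have hsum : ∀ t : ℝ, HasSum (fun k : ℕ => ((ω : ℂ)⁻¹) ^ k • ((u k).1 + (u k).2.2.fn (ω * t) +
      aLin a (u (k + 1)).2.1)) (x t - (ω : ℂ) • aLin a (u 0).2.1) := by
    intro t
    have hs : Summable (fun k : ℕ => ((ω : ℂ)⁻¹) ^ k • ((u k).1 + (u k).2.2.fn (ω * t) +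
      aLin a (u (k + 1)).2.1)) := Summable.of_norm_bounded hgeo (hterm t)
    have e1 : ∀ r, ∑ k ∈ Finset.range r, ((ω : ℂ)⁻¹) ^ k • ((u k).1 + (u k).2.2.fn (ω * t) +
        aLin a (u (k + 1)).2.1) =
        (∑ k ∈ Finset.range r, ((ω : ℂ)⁻¹) ^ k • u k).1 +
        (∑ k ∈ Finset.range r, ((ω : ℂ)⁻¹) ^ k • u k).2.2.fn (ω * t) +
        (ω : ℂ) • (aLin a (∑ k ∈ Finset.range (r + 1), ((ω : ℂ)⁻¹) ^ k • u k).2.1 -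
          aLin a (u 0).2.1) := by
      intro r
      have h3 : ∀ k, ((ω : ℂ)⁻¹) ^ k = (ω : ℂ) * ((ω : ℂ)⁻¹) ^ (k + 1) := by
        intro k; rw [pow_succ']; field_simp
      induction r with
      | zero => simp
      | succ r ih =>
        rw [Finset.sum_range_succ, ih, Finset.sum_range_succ _ (r + 1), Finset.sum_range_succ _ r]
        simp only [Prod.fst_add, Prod.snd_add, Prod.smul_fst, Prod.smul_snd, PerE.add_fn,
          PerE.smul_fn, map_add, map_smul, smul_add, smul_sub]
        rw [smul_smul (ω : ℂ) _ (aLin a (u (r + 1)).2.1), ← h3]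
        abel
    have l1 : Filter.Tendsto (fun r => (∑ k ∈ Finset.range r, ((ω : ℂ)⁻¹) ^ k • u k).1)
        Filter.atTop (nhds v.1) := (continuous_fst.tendsto v).comp hlim
    have l2 : Filter.Tendsto (fun r => (∑ k ∈ Finset.range r, ((ω : ℂ)⁻¹) ^ k • u k).2.2.fn (ω * t))
        Filter.atTop (nhds (v.2.2.fn (ω * t))) :=
      (((evE (ω * t)).continuous.comp (continuous_snd.comp continuous_snd)).tendsto v).comp hlim
    have l3 : Filter.Tendsto
        (fun r => aLin a (∑ k ∈ Finset.range (r + 1), ((ω : ℂ)⁻¹) ^ k • u k).2.1)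
        Filter.atTop (nhds (aLin a v.2.1)) :=
      (((aLin a).continuous.comp (continuous_fst.comp continuous_snd)).tendsto v).comp
        (hlim.comp (Filter.tendsto_add_atTop_nat 1))
    have l4 := (l1.add l2).add ((l3.sub_const (aLin a (u 0).2.1)).const_smul (ω : ℂ))
    simp only [← e1] at l4
    have e2 : x t - (ω : ℂ) • aLin a (u 0).2.1 = v.1 + v.2.2.fn (ω * t) +
        (ω : ℂ) • (aLin a v.2.1 - aLin a (u 0).2.1) := by
      rw [hv t, smul_sub]; abel
    rw [e2]
    exact (hs.hasSum_iff_tendsto_nat).2 l4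
  refine ⟨hsum, ⟨fun k => (n + 1) * (c * (ρ / ω) ^ k), hgeo.mul_left _, fun k t => ?_⟩, ?_⟩
  · refine (euclNorm_le _).trans ?_
    exact mul_le_mul_of_nonneg_left (hterm t k) (by positivity)
  · intro r t
    refine (euclNorm_le _).trans ?_
    have h1 := norm_sub_le_of_geometric_bound_of_hasSum (by linarith) (hterm t) (hsum t) (r + 1)
    rw [norm_sub_rev] at h1
    have h2 : c * (ρ / ω) ^ (r + 1) / (1 - ρ / ω) ≤ 2 * c * (ρ / ω) ^ (r + 1) := by
      rw [div_le_iff₀ (by linarith)]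
      have : 0 ≤ c * (ρ / ω) ^ (r + 1) := by positivity
      nlinarith
    have h3 : 1 + 2 * (n + 1) * c ≤ (1 + 2 * (n + 1) * c) ^ (r + 1) :=
      le_self_pow₀ (by have : 0 ≤ 2 * (n + 1) * c := by positivity
                       linarith) (by omega)
    calc (n + 1 : ℝ) * _ ≤ (n + 1) * (2 * c * (ρ / ω) ^ (r + 1)) := by
          gcongr
          exact h1.trans h2
      _ ≤ (1 + 2 * (n + 1) * c) * (ρ / ω) ^ (r + 1) := by
          have : 0 ≤ (ρ / ω) ^ (r + 1) := by positivity
          nlinarith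
      _ ≤ (1 + 2 * (n + 1) * c) ^ (r + 1) * (ρ / ω) ^ (r + 1) := by gcongr
      _ = M₀ ^ (r + 1) / ω ^ (r + 1) := by rw [hM, div_pow, mul_pow]; ring
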